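/- arXiv:2309.00644 — 3 statements merged into one kernel-verified Lean document; each statement's English description precedes it below -/
import Mathlib

section
/- Let D ≥ 1 be an integer, let a ≥ 1 be a real number, and define f₃(x) = x₁² + Σ_{n=2}^D |x_n³| for x ∈ ℝ^D. If x satisfies either the constraint |x₁ − 2a| + Σ_{n=2}^D |x_n| ≤ a or the constraint Σ_{n=1}^D (x_n − 5a)² ≤ a², then f₃(x) ≥ a². Moreover the point x* = (a, 0, …, 0) satisfies the first constraint and f₃(x*) = a², so the minimum value of f₃ over the union of the two feasible domains equals a². -/
open Real Finset

theorem f3_constrained_min (D : ℕ) (hD : 1 ≤ D) (a : ℝ) (ha : 1 ≤ a)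
    (f₃ : (Fin D → ℝ) → ℝ)
    (hf : ∀ x, f₃ x = x ⟨0, hD⟩ ^ 2 + ∑ n ∈ Finset.univ.erase ⟨0, hD⟩, |x n ^ 3|) :
    (∀ x : Fin D → ℝ,
      (|x ⟨0, hD⟩ - 2 * a| + ∑ n ∈ Finset.univ.erase ⟨0, hD⟩, |x n| ≤ a) ∨
      (∑ n : Fin D, (x n - 5 * a) ^ 2 ≤ a ^ 2) →
      f₃ x ≥ a ^ 2) ∧
    (|(fun n : Fin D => if n = ⟨0, hD⟩ then a else 0) ⟨0, hD⟩ - 2 * a|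
      + ∑ n ∈ Finset.univ.erase ⟨0, hD⟩,
          |(fun n : Fin D => if n = ⟨0, hD⟩ then a else 0) n| ≤ a) ∧
    f₃ (fun n : Fin D => if n = ⟨0, hD⟩ then a else 0) = a ^ 2 := by
  have hz : ∀ n ∈ Finset.univ.erase (⟨0, hD⟩ : Fin D), n ≠ ⟨0, hD⟩ :=
    fun n hn => Finset.ne_of_mem_erase hn
  refine ⟨?_, ?_, ?_⟩
  · intro x hx
    have hxa : a ≤ x ⟨0, hD⟩ := by
      rcases hx with h | h
      · have h1 : 0 ≤ ∑ n ∈ Finset.univ.erase (⟨0, hD⟩ : Fin D), |x n| :=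
          Finset.sum_nonneg fun n _ => abs_nonneg _
        have h2 := neg_abs_le (x ⟨0, hD⟩ - 2 * a)
        linarith
      · have h1 : (x ⟨0, hD⟩ - 5 * a) ^ 2 ≤ ∑ n : Fin D, (x n - 5 * a) ^ 2 :=
          Finset.single_le_sum (f := fun n : Fin D => (x n - 5 * a) ^ 2)
            (fun n _ => sq_nonneg _) (Finset.mem_univ _)
        have h2 := (abs_le_of_sq_le_sq' (h1.trans h) (by linarith)).1
        linarith
    have h3 : 0 ≤ ∑ n ∈ Finset.univ.erase (⟨0, hD⟩ : Fin D), |x n ^ 3| :=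
      Finset.sum_nonneg fun n _ => abs_nonneg _
    rw [hf]
    nlinarith
  · rw [Finset.sum_eq_zero (fun n hn => by simp [hz n hn])]
    simp only [if_true, add_zero]
    rw [abs_le]
    constructor <;> linarith
  · rw [hf, Finset.sum_eq_zero (fun n hn => by simp [hz n hn])]
    simp
end

section
/- Consider the set S = {x ∈ ℝ : |x| + cos(x²) < 1}, which is exactly the set of global minimizers of f(x) = ⌊|x| + cos(x²)⌋. The following hold: (i) for every x with |x| ≤ 1.4, |x| + cos(x²) ≥ 1; (ii) for every x with |x| ≥ 2, |x| + cos(x²) ≥ 1; (iii) 1.7 ∈ S and −1.7 ∈ S. Consequently S is a nonempty subset of {x : 1.4 < |x| < 2} meeting both the positive and the negative half-line, so the set of optimal solutions consists of at least two disconnected regions. -/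
open Real Set

lemma aux_small (t : ℝ) (h0 : 0 ≤ t) (h : t ≤ 1.4) : t + Real.cos (t ^ 2) ≥ 1 := by
  norm_num at h
  have hpi := Real.pi_gt_d2
  norm_num at hpi
  rcases le_total t 1 with h1 | h1
  · have hc := Real.one_sub_sq_div_two_le_cos (x := t ^ 2)
    have h3 : t ^ 4 ≤ t := by
      have := pow_le_pow_of_le_one h0 h1 (show 1 ≤ 4 by norm_num)
      simpa using this
    have h4 : (t ^ 2) ^ 2 = t ^ 4 := by ring
    rw [h4] at hc
    linarith
  · rcases le_total (t ^ 2) (π / 2) with h2 | h2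
    · have := Real.cos_nonneg_of_neg_pi_div_two_le_of_le
        (x := t ^ 2) (by nlinarith) h2
      linarith
    · have hs := Real.sin_le (x := t ^ 2 - π / 2) (by linarith)
      rw [Real.sin_sub_pi_div_two] at hs
      nlinarith

lemma aux_mid : (1.7 : ℝ) + Real.cos (1.7 ^ 2) < 1 := by
  have h1 := Real.pi_gt_d2
  have h2 := Real.pi_lt_d2
  have hc := Real.one_sub_sq_div_two_le_cos (x := π - 1.7 ^ 2)
  rw [Real.cos_pi_sub] at hc
  norm_num at *
  nlinarith

theorem minimizer_set_disconnected (S : Set ℝ)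
    (hS : S = {x : ℝ | |x| + Real.cos (x ^ 2) < 1}) :
    (∀ x : ℝ, |x| ≤ 1.4 → |x| + Real.cos (x ^ 2) ≥ 1) ∧
    (∀ x : ℝ, |x| ≥ 2 → |x| + Real.cos (x ^ 2) ≥ 1) ∧
    (1.7 : ℝ) ∈ S ∧ (-1.7 : ℝ) ∈ S ∧
    S ⊆ {x : ℝ | 1.4 < |x| ∧ |x| < 2} ∧
    (∃ x ∈ S, 0 < x) ∧ (∃ x ∈ S, x < 0) := by
  have A : ∀ x : ℝ, |x| ≤ 1.4 → |x| + Real.cos (x ^ 2) ≥ 1 := by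
    intro x hx
    have := aux_small |x| (abs_nonneg x) hx
    rwa [sq_abs] at this
  have B : ∀ x : ℝ, |x| ≥ 2 → |x| + Real.cos (x ^ 2) ≥ 1 := by
    intro x hx
    have := Real.neg_one_le_cos (x ^ 2)
    linarith
  have C : (1.7 : ℝ) ∈ S := by
    rw [hS, mem_setOf_eq, abs_of_pos (by norm_num)]
    exact aux_mid
  have D : (-1.7 : ℝ) ∈ S := by
    rw [hS, mem_setOf_eq, abs_neg, neg_sq, abs_of_pos (by norm_num)]
    exact aux_mid
  refine ⟨A, B, C, D, ?_, ⟨_, C, by norm_num⟩, ⟨_, D, by norm_num⟩⟩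
  intro x hx
  rw [hS, mem_setOf_eq] at hx
  constructor
  · by_contra h
    exact absurd hx (not_lt.mpr (A x (not_lt.mp h)))
  · by_contra h
    exact absurd hx (not_lt.mpr (B x (not_lt.mp h)))
end

section
/- For every real number β > 0, the improper integral ∫₀^∞ (sin x / x) · e^{−βx} dx converges and equals π/2 − arctan β. -/
open Real MeasureTheory

lemma integral_cos_exp_aux (β t : ℝ) (hβ : 0 < β) :
    ∫ x in Set.Ioi (0 : ℝ), Real.cos (t * x) * Real.exp (-β * x) = β / (β ^ 2 + t ^ 2) := by
  have ha : ((-β : ℂ) + t * Complex.I).re < 0 := by simpa using hβ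
  have h1 := integral_exp_mul_complex_Ioi ha 0
  have h2 := integrableOn_exp_mul_complex_Ioi ha 0
  have h3 := integral_re h2
  rw [h1] at h3
  have h4 : ∀ x : ℝ, Real.cos (t * x) * Real.exp (-β * x) =
      RCLike.re (Complex.exp (((-β : ℂ) + t * Complex.I) * x)) := by
    intro x
    simp [Complex.exp_re, mul_comm]
  simp_rw [h4]
  rw [h3]
  simp [Complex.div_re, Complex.normSq_apply]
  ring

theorem integral_sinc_exp (β : ℝ) (hβ : 0 < β) :
    IntegrableOn (fun x : ℝ => Real.sin x / x * Real.exp (-β * x)) (Set.Ioi 0) ∧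
    ∫ x in Set.Ioi (0 : ℝ), Real.sin x / x * Real.exp (-β * x) =
      Real.pi / 2 - Real.arctan β := by
  have hexp : IntegrableOn (fun x : ℝ => Real.exp (-β * x)) (Set.Ioi 0) :=
    integrableOn_exp_mul_Ioi (by linarith) 0
  have hmeas : ∀ t : ℝ, AEStronglyMeasurable
      (fun x : ℝ => Real.sin (t * x) / x * Real.exp (-β * x))
      (volume.restrict (Set.Ioi 0)) := by
    intro t
    exact Measurable.aestronglyMeasurable (by fun_prop)
  have hint : ∀ t : ℝ, IntegrableOn
      (fun x : ℝ => Real.sin (t * x) / x * Real.exp (-β * x)) (Set.Ioi 0) := by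
    intro t
    refine Integrable.mono' (hexp.const_mul |t|) (hmeas t) ?_
    filter_upwards [ae_restrict_mem measurableSet_Ioi] with x hx
    have hx : 0 < x := hx
    rw [norm_mul, norm_div, Real.norm_eq_abs, Real.norm_eq_abs, Real.norm_eq_abs, abs_exp,
      abs_of_pos hx]
    gcongr
    rw [div_le_iff₀ hx]
    calc |Real.sin (t * x)| ≤ |t * x| := Real.abs_sin_le_abs
      _ = |t| * x := by rw [abs_mul, abs_of_pos hx]
  have hder : ∀ t : ℝ, HasDerivAt
      (fun t => ∫ x in Set.Ioi (0 : ℝ), Real.sin (t * x) / x * Real.exp (-β * x))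
      (β / (β ^ 2 + t ^ 2)) t := by
    intro t
    rw [← integral_cos_exp_aux β t hβ]
    refine (hasDerivAt_integral_of_dominated_loc_of_deriv_le
      (F := fun t x => Real.sin (t * x) / x * Real.exp (-β * x))
      (F' := fun t x => Real.cos (t * x) * Real.exp (-β * x))
      (bound := fun x => Real.exp (-β * x)) (s := Set.univ)
      Filter.univ_mem (Filter.Eventually.of_forall hmeas) (hint t) ?_ ?_ hexp ?_).2
    · exact Measurable.aestronglyMeasurable (by fun_prop)
    · refine Filter.Eventually.of_forall fun x s _ => ?_
      rw [norm_mul, Real.norm_eq_abs, Real.norm_eq_abs, abs_exp]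
      exact mul_le_of_le_one_left (Real.exp_pos _).le (Real.abs_cos_le_one _)
    · filter_upwards [ae_restrict_mem measurableSet_Ioi] with x hx s _
      have hx : x ≠ 0 := ne_of_gt hx
      have := ((((hasDerivAt_id' s).mul_const x).sin).div_const x).mul_const (Real.exp (-β * x))
      exact this.congr_deriv (by field_simp)
  have hder2 : ∀ t : ℝ, HasDerivAt (fun t => Real.arctan (t / β)) (β / (β ^ 2 + t ^ 2)) t := by
    intro t
    have := ((hasDerivAt_id' t).div_const β).arctan
    convert this using 1
    have : β ^ 2 + t ^ 2 ≠ 0 := by positivity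
    field_simp
  have hc := is_const_of_deriv_eq_zero
    (fun t => ((hder t).sub (hder2 t)).differentiableAt)
    (fun t => by rw [((hder t).sub (hder2 t)).deriv, sub_self]) 1 0
  have h1 := hint 1
  simp only [one_mul] at h1
  refine ⟨h1, ?_⟩
  simp only [Pi.sub_apply, one_mul, zero_mul, Real.sin_zero, zero_div, integral_zero,
    Real.arctan_zero, sub_zero, one_div] at hc
  rw [← Real.arctan_inv_of_pos hβ]
  linarith
end
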